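/- arXiv:1903.05975 — 2 statements merged into one kernel-verified Lean document; each statement's English description precedes it below -/
import Mathlib

section
/- Every preference profile on 2n agents that is complete (ties allowed), narcissistic, and single-peaked admits a stable matching; moreover such a profile admits a perfect stable matching, i.e., a stable matching in which every agent is matched. -/
/-!
Basic framework: preference profiles with possibly incomplete preferences and ties,
structured-preference properties (narcissistic, single-peaked, single-crossing,
tie-sensitive single-crossing), matchings, blocking pairs and stability.
-/

/-- A preference profile: each agent `i` has a weak order `pref i` (transitive and
total) on its acceptable set `acc i`.  `pref i x y` means agent `i` weakly prefers
`x` to `y`. -/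
structure Profile (V : Type*) where
  acc : V → Set V
  pref : V → V → V → Prop
  pref_mem : ∀ i x y, pref i x y → x ∈ acc i ∧ y ∈ acc i
  pref_total : ∀ i x y, x ∈ acc i → y ∈ acc i → pref i x y ∨ pref i y x
  pref_trans : ∀ i x y z, pref i x y → pref i y z → pref i x z

namespace Profile

variable {V : Type*} (P : Profile V)

/-- `i` strictly prefers `x` to `y`. -/
def Strict (i x y : V) : Prop := P.pref i x y ∧ ¬ P.pref i y x

/-- `i` is indifferent between (ties) `x` and `y`. -/
def Indiff (i x y : V) : Prop := P.pref i x y ∧ P.pref i y x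

/-- Acceptability is symmetric between distinct agents. -/
def AccSymm : Prop := ∀ i j : V, i ≠ j → (j ∈ P.acc i ↔ i ∈ P.acc j)

/-- The profile has no ties. -/
def NoTies : Prop := ∀ i x y : V, x ≠ y → ¬ P.Indiff i x y

/-- The profile is complete: `V(≽ᵢ) ∪ {i} = V` for every agent `i`. -/
def IsComplete : Prop := ∀ i : V, P.acc i ∪ {i} = Set.univ

/-- The profile is narcissistic. -/
def Narcissistic : Prop :=
  ∀ i : V, i ∈ P.acc i ∧ ∀ j ∈ P.acc i, j ≠ i → P.Strict i i j

/-- The agents of a set `S` are narcissistic. -/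
def NarcissisticOn (S : Set V) : Prop :=
  ∀ i ∈ S, i ∈ P.acc i ∧ ∀ j ∈ P.acc i, j ≠ i → P.Strict i i j

/-- `X ▷ Y` : every member of `X` strictly precedes every member of `Y` w.r.t. `lt`. -/
def SetBefore (lt : V → V → Prop) (X Y : Set V) : Prop :=
  ∀ x ∈ X, ∀ y ∈ Y, lt x y

/-- `V[x ≻ y]`: the agents that find both `x` and `y` acceptable and strictly
prefer `x` to `y`. -/
def prefersSet (x y : V) : Set V :=
  {i | x ∈ P.acc i ∧ y ∈ P.acc i ∧ P.Strict i x y}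

/-- `V[x ∼ y]`: the agents that find both `x` and `y` acceptable and are
indifferent between them. -/
def tiesSet (x y : V) : Set V :=
  {i | x ∈ P.acc i ∧ y ∈ P.acc i ∧ P.Indiff i x y}

/-- `V[x ≻ y]` restricted to the agents of `S`. -/
def prefersSetOn (S : Set V) (x y : V) : Set V :=
  {i | i ∈ S ∧ x ∈ P.acc i ∧ y ∈ P.acc i ∧ P.Strict i x y}

/-- `V[x ∼ y]` restricted to the agents of `S`. -/
def tiesSetOn (S : Set V) (x y : V) : Set V :=
  {i | i ∈ S ∧ x ∈ P.acc i ∧ y ∈ P.acc i ∧ P.Indiff i x y}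

/-- The profile is single-peaked with respect to the linear order `lt`. -/
def SinglePeakedWrt (lt : V → V → Prop) : Prop :=
  ∀ i x y z : V, x ∈ P.acc i → y ∈ P.acc i → z ∈ P.acc i →
    lt x y → lt y z → P.Strict i x y → P.pref i y z

/-- The profile is single-peaked. -/
def SinglePeaked : Prop :=
  ∃ lt : V → V → Prop, IsStrictTotalOrder V lt ∧ P.SinglePeakedWrt lt

/-- The preferences of the agents of `S` are single-peaked w.r.t. `lt`. -/
def SinglePeakedWrtOn (S : Set V) (lt : V → V → Prop) : Prop :=
  ∀ i ∈ S, ∀ x y z : V, x ∈ P.acc i → y ∈ P.acc i → z ∈ P.acc i →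
    lt x y → lt y z → P.Strict i x y → P.pref i y z

/-- The profile is tie-sensitive single-crossing with respect to `lt`:
for each pair `{x, y}` of distinct agents either
`V[x ≻ y] ▷ V[x ∼ y] ▷ V[y ≻ x]` or `V[y ≻ x] ▷ V[x ∼ y] ▷ V[x ≻ y]`. -/
def TSSingleCrossingWrt (lt : V → V → Prop) : Prop :=
  ∀ x y : V, x ≠ y →
    (SetBefore lt (P.prefersSet x y) (P.tiesSet x y) ∧
     SetBefore lt (P.tiesSet x y) (P.prefersSet y x) ∧
     SetBefore lt (P.prefersSet x y) (P.prefersSet y x)) ∨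
    (SetBefore lt (P.prefersSet y x) (P.tiesSet x y) ∧
     SetBefore lt (P.tiesSet x y) (P.prefersSet x y) ∧
     SetBefore lt (P.prefersSet y x) (P.prefersSet x y))

/-- The profile is tie-sensitive single-crossing. -/
def TSSingleCrossing : Prop :=
  ∃ lt : V → V → Prop, IsStrictTotalOrder V lt ∧ P.TSSingleCrossingWrt lt

/-- Tie-sensitive single-crossingness of the preferences of the agents of `S`. -/
def TSSingleCrossingWrtOn (S : Set V) (lt : V → V → Prop) : Prop :=
  ∀ x y : V, x ≠ y →
    (SetBefore lt (P.prefersSetOn S x y) (P.tiesSetOn S x y) ∧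
     SetBefore lt (P.tiesSetOn S x y) (P.prefersSetOn S y x) ∧
     SetBefore lt (P.prefersSetOn S x y) (P.prefersSetOn S y x)) ∨
    (SetBefore lt (P.prefersSetOn S y x) (P.tiesSetOn S x y) ∧
     SetBefore lt (P.tiesSetOn S x y) (P.prefersSetOn S x y) ∧
     SetBefore lt (P.prefersSetOn S y x) (P.prefersSetOn S x y))

/-- `ext` is a linear extension of the profile: for every agent `i`, `ext i` is a
strict linear order on the acceptable set `acc i` that contains `Strict i`. -/
def IsLinearExt (ext : V → V → V → Prop) : Prop :=
  (∀ i x y, ext i x y → x ∈ P.acc i ∧ y ∈ P.acc i) ∧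
  (∀ i x, ¬ ext i x x) ∧
  (∀ i x y z, ext i x y → ext i y z → ext i x z) ∧
  (∀ i x y, x ∈ P.acc i → y ∈ P.acc i → x ≠ y → (ext i x y ∨ ext i y x)) ∧
  (∀ i x y, ext i x y → ¬ ext i y x) ∧
  (∀ i x y, P.Strict i x y → ext i x y)

/-- `V[x ≻' y]` for a linear extension `ext`. -/
def extPrefersSet (ext : V → V → V → Prop) (x y : V) : Set V :=
  {i | x ∈ P.acc i ∧ y ∈ P.acc i ∧ ext i x y}

/-- The linear extension `ext` witnesses single-crossingness w.r.t. `lt`. -/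
def SingleCrossingWrtVia (ext : V → V → V → Prop) (lt : V → V → Prop) : Prop :=
  ∀ x y : V, x ≠ y →
    SetBefore lt (P.extPrefersSet ext x y) (P.extPrefersSet ext y x) ∨
    SetBefore lt (P.extPrefersSet ext y x) (P.extPrefersSet ext x y)

/-- The profile is single-crossing with respect to `lt`: some linear extension
of the profile crosses each pair at most once along `lt`. -/
def SingleCrossingWrt (lt : V → V → Prop) : Prop :=
  ∃ ext : V → V → V → Prop, P.IsLinearExt ext ∧ P.SingleCrossingWrtVia ext lt

/-- The profile is single-crossing. -/
def SingleCrossing : Prop :=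
  ∃ lt : V → V → Prop, IsStrictTotalOrder V lt ∧ P.SingleCrossingWrt lt

/-- Single-crossingness w.r.t. `lt` for profiles without ties, stated directly via
the strict preferences. -/
def SCNoTiesWrt (lt : V → V → Prop) : Prop :=
  ∀ x y : V, x ≠ y →
    SetBefore lt (P.prefersSet x y) (P.prefersSet y x) ∨
    SetBefore lt (P.prefersSet y x) (P.prefersSet x y)

/-- `x` is a most acceptable agent of `y`. -/
def MostAcceptable (x y : V) : Prop :=
  x ∈ P.acc y ∧ x ≠ y ∧ ∀ z ∈ P.acc y, z ≠ x → z ≠ y → P.pref y x z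

/-- A matching: a set of pairwise disjoint pairs of distinct, mutually acceptable
agents, encoded by the partner function `m` (`m x = none` iff `x` is unmatched). -/
structure Matching (Q : Profile V) where
  m : V → Option V
  ne : ∀ x y, m x = some y → x ≠ y
  mutual_acc : ∀ x y, m x = some y → y ∈ Q.acc x ∧ x ∈ Q.acc y
  symm : ∀ x y, m x = some y → m y = some x

/-- The (mutually acceptable, unmatched) pair `{x, y}` blocks the matching `M`. -/
def Matching.Blocks {Q : Profile V} (M : Q.Matching) (x y : V) : Prop :=
  x ≠ y ∧ y ∈ Q.acc x ∧ x ∈ Q.acc y ∧ M.m x ≠ some y ∧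
  (∀ z, M.m x = some z → Q.Strict x y z) ∧
  (∀ z, M.m y = some z → Q.Strict y x z)

/-- A matching is stable if no pair blocks it. -/
def Matching.Stable {Q : Profile V} (M : Q.Matching) : Prop :=
  ∀ x y : V, ¬ M.Blocks x y

/-- A matching is perfect if every agent is matched. -/
def Matching.Perfect {Q : Profile V} (M : Q.Matching) : Prop :=
  ∀ x : V, M.m x ≠ none

/-- Build a profile from ranking functions (`none` = unacceptable, smaller rank =
more preferred). -/
def ofRank {V : Type*} (rk : V → V → Option ℕ) : Profile V where
  acc i := {x | rk i x ≠ none}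
  pref i x y := ∃ a b : ℕ, rk i x = some a ∧ rk i y = some b ∧ a ≤ b
  pref_mem i x y := by
    rintro ⟨a, b, ha, hb, -⟩
    constructor <;> simp only [Set.mem_setOf_eq, ha, hb] <;> simp
  pref_total i x y hx hy := by
    obtain ⟨a, ha⟩ := Option.ne_none_iff_exists'.mp hx
    obtain ⟨b, hb⟩ := Option.ne_none_iff_exists'.mp hy
    rcases le_total a b with h | h
    · exact Or.inl ⟨a, b, ha, hb, h⟩
    · exact Or.inr ⟨b, a, hb, ha, h⟩
  pref_trans i x y z := by
    rintro ⟨a, b, ha, hb, hab⟩ ⟨b', c, hb', hc, hbc⟩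
    refine ⟨a, c, ha, hc, hab.trans ?_⟩
    rw [hb] at hb'
    rwa [Option.some_inj.mp hb']

end Profile

namespace Profile

theorem IsComplete.mem_acc {V : Type*} {P : Profile V} (hc : P.IsComplete)
    (hn : P.Narcissistic) (i j : V) : j ∈ P.acc i := by
  have h : j ∈ P.acc i ∪ {i} := by rw [hc i]; trivial
  rcases h with h | h
  · exact h
  · rw [Set.mem_singleton_iff.mp h]
    exact (hn i).1

/-- Agent `i` has a weakly best element in every nonempty finite set of acceptable agents. -/
theorem exists_pref_forall_mem {V : Type*} (P : Profile V) (i : V) {T : Finset V}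
    (hT : T.Nonempty) (hacc : ∀ x ∈ T, x ∈ P.acc i) :
    ∃ b ∈ T, ∀ z ∈ T, P.pref i b z := by
  induction hT using Finset.Nonempty.cons_induction with
  | singleton a =>
    have ha := hacc a (by simp)
    exact ⟨a, by simp, fun z hz => by
      rw [Finset.mem_singleton.mp hz]
      exact or_self_iff.mp (P.pref_total i a a ha ha)⟩
  | cons a s ha hs ih =>
    obtain ⟨b, hb, hbest⟩ := ih fun x hx => hacc x (Finset.mem_cons_of_mem hx)
    have hamem := hacc a (Finset.mem_cons_self a s)
    rcases P.pref_total i a b hamem (hacc b (Finset.mem_cons_of_mem hb)) with h | h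
    · refine ⟨a, Finset.mem_cons_self a s, fun z hz => ?_⟩
      rcases Finset.mem_cons.mp hz with rfl | hz
      · exact or_self_iff.mp (P.pref_total i z z hamem hamem)
      · exact P.pref_trans i a b z h (hbest z hz)
    · refine ⟨b, Finset.mem_cons_of_mem hb, fun z hz => ?_⟩
      rcases Finset.mem_cons.mp hz with rfl | hz
      · exact h
      · exact hbest z hz

/-- Any set of at least two agents contains two agents that are weakly best for each other
within the set. -/
theorem exists_mutually_best {V : Type*} {P : Profile V} (hc : P.IsComplete)
    (hn : P.Narcissistic) (hsp : P.SinglePeaked) {S : Finset V} (hS : 1 < S.card) :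
    ∃ a ∈ S, ∃ b ∈ S, a ≠ b ∧ (∀ z ∈ S, z ≠ a → P.pref a b z) ∧
      ∀ z ∈ S, z ≠ b → P.pref b a z := by
  classical
  obtain ⟨lt, hlt, hsp⟩ := hsp
  let : LinearOrder V := linearOrderOfSTO lt
  have hacc := hc.mem_acc hn
  have hright : ∀ i x y : V, i < x → x ≤ y → P.pref i x y := by
    intro i x y hix hxy
    rcases hxy.eq_or_lt with rfl | hxy
    · exact or_self_iff.mp (P.pref_total i x x (hacc i x) (hacc i x))
    · exact hsp i i x y (hacc i i) (hacc i x) (hacc i y) hix hxy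
        ((hn i).2 x (hacc i x) hix.ne')
  have hleft : ∀ i x y : V, y ≤ x → x < i → P.pref i x y := by
    intro i x y hyx hxi
    rcases hyx.eq_or_lt with rfl | hyx
    · exact or_self_iff.mp (P.pref_total i y y (hacc i y) (hacc i y))
    · by_contra hxy
      have hpref := (P.pref_total i x y (hacc i x) (hacc i y)).resolve_left hxy
      exact ((hn i).2 x (hacc i x) hxi.ne).2
        (hsp i y x i (hacc i y) (hacc i x) (hacc i i) hyx hxi ⟨hpref, hxy⟩)
  have hbest : ∀ i, ∃ c ∈ S.erase i, ∀ z ∈ S.erase i, P.pref i c z := by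
    intro i
    refine P.exists_pref_forall_mem i (Finset.card_pos.mp ?_) fun x _ => hacc i x
    have := S.pred_card_le_card_erase (a := i)
    omega
  let T := {i ∈ S | ∃ c ∈ S, c < i ∧ ∀ z ∈ S.erase i, P.pref i c z}
  have hT : T.Nonempty := by
    obtain ⟨m, hm, hmax⟩ := S.exists_max_image id (Finset.card_pos.mp (by omega))
    obtain ⟨c, hcm, hcbest⟩ := hbest m
    have hcS := Finset.mem_of_mem_erase hcm
    exact ⟨m, Finset.mem_filter.mpr ⟨hm, c, hcS,
      lt_of_le_of_ne (hmax c hcS) (Finset.ne_of_mem_erase hcm), hcbest⟩⟩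
  obtain ⟨b, hbT, hbmin⟩ := T.exists_min_image id hT
  obtain ⟨hb, c, hcS, hcb, hcbest⟩ := Finset.mem_filter.mp hbT
  obtain ⟨a, haL, hamax⟩ := {s ∈ S | s < b}.exists_max_image id
    ⟨c, Finset.mem_filter.mpr ⟨hcS, hcb⟩⟩
  obtain ⟨ha, hab⟩ := Finset.mem_filter.mp haL
  refine ⟨a, ha, b, hb, hab.ne, fun z hz hza => ?_, fun z hz hzb => ?_⟩
  · obtain ⟨d, hd, hdbest⟩ := hbest a
    obtain ⟨hda, hdS⟩ := Finset.mem_erase.mp hd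
    have had : a < d := by
      by_contra h
      have hdlt : d < a := lt_of_le_of_ne (not_lt.mp h) hda
      exact hab.not_ge (hbmin a (Finset.mem_filter.mpr ⟨ha, d, hdS, hdlt, hdbest⟩))
    have hbd : b ≤ d := by
      by_contra h
      exact had.not_ge (hamax d (Finset.mem_filter.mpr ⟨hdS, not_le.mp h⟩))
    exact P.pref_trans a b d z (hright a b d hab hbd)
      (hdbest z (Finset.mem_erase.mpr ⟨hza, hz⟩))
  · have hca : c ≤ a := hamax c (Finset.mem_filter.mpr ⟨hcS, hcb⟩)
    exact P.pref_trans b a c z (hleft b a c hca hab)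
      (hcbest z (Finset.mem_erase.mpr ⟨hzb, hz⟩))

/-- A set of even size has a fixed-point-free involution that no pair of its members blocks. -/
theorem exists_stable_involution {V : Type*} {P : Profile V} (hc : P.IsComplete)
    (hn : P.Narcissistic) (hsp : P.SinglePeaked) (n : ℕ) :
    ∀ S : Finset V, S.card = 2 * n → ∃ f : V → V,
      (∀ x ∈ S, f x ∈ S ∧ f x ≠ x ∧ f (f x) = x) ∧
      ∀ x ∈ S, ∀ y ∈ S, x ≠ y → P.Strict x y (f x) → ¬ P.Strict y x (f y) := by
  classical
  induction n with
  | zero =>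
    intro S hS
    obtain rfl : S = ∅ := Finset.card_eq_zero.mp hS
    exact ⟨id, by simp, by simp⟩
  | succ n ih =>
    intro S hS
    obtain ⟨a, ha, b, hb, hab, hbesta, hbestb⟩ :=
      exists_mutually_best hc hn hsp (S := S) (by omega)
    have hba : b ∈ S.erase a := Finset.mem_erase.mpr ⟨hab.symm, hb⟩
    obtain ⟨f, hf, hstable⟩ := ih ((S.erase a).erase b) (by
      rw [Finset.card_erase_of_mem hba, Finset.card_erase_of_mem ha]; omega)
    have hmem : ∀ x ∈ S, x ≠ a → x ≠ b → x ∈ (S.erase a).erase b := by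
      intro x hx hxa hxb
      simp [*]
    refine ⟨fun x => if x = a then b else if x = b then a else f x, fun x hx => ?_,
      fun x hx y hy hxy => ?_⟩
    · by_cases hxa : x = a
      · subst hxa
        simp [hb, hab.symm]
      by_cases hxb : x = b
      · subst hxb
        simp [ha, hab, hab.symm]
      obtain ⟨h1, h2, h3⟩ := hf x (hmem x hx hxa hxb)
      simp only [Finset.mem_erase] at h1
      simp [hxa, hxb, h1, h2, h3]
    · by_cases hxa : x = a
      · subst hxa
        intro h
        exact absurd (hbesta y hy hxy.symm) (by simpa using h.2)
      by_cases hxb : x = b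
      · subst hxb
        intro h
        exact absurd (hbestb y hy hxy.symm) (by simpa [hab.symm] using h.2)
      by_cases hya : y = a
      · subst hya
        intro _ h
        exact absurd (hbesta x hx hxy) (by simpa using h.2)
      by_cases hyb : y = b
      · subst hyb
        intro _ h
        exact absurd (hbestb x hx hxy) (by simpa [hab.symm] using h.2)
      simpa [hxa, hxb, hya, hyb] using
        hstable x (hmem x hx hxa hxb) y (hmem y hy hya hyb) hxy

end Profile

/-- Every complete (possibly with ties), narcissistic and
single-peaked profile on `2 * n` agents admits a stable matching; moreover it admits
a perfect stable matching. -/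
theorem exists_stable_of_complete_narcissistic_singlePeaked {V : Type*} [Fintype V]
    (n : ℕ) (hcard : Fintype.card V = 2 * n) (P : Profile V)
    (hc : P.IsComplete) (hn : P.Narcissistic) (hsp : P.SinglePeaked) :
    (∃ M : P.Matching, M.Stable) ∧ (∃ M : P.Matching, M.Stable ∧ M.Perfect) := by
  obtain ⟨f, hf, hstable⟩ := Profile.exists_stable_involution hc hn hsp n Finset.univ hcard
  let M : P.Matching :=
    { m := fun x => some (f x)
      ne := by
        rintro x _ ⟨⟩
        exact (hf x (Finset.mem_univ x)).2.1.symm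
      mutual_acc := fun x y _ => ⟨hc.mem_acc hn x y, hc.mem_acc hn y x⟩
      symm := by
        rintro x _ ⟨⟩
        exact congrArg some (hf x (Finset.mem_univ x)).2.2 }
  have hM : M.Stable := by
    rintro x y ⟨hxy, -, -, -, hx, hy⟩
    exact hstable x (Finset.mem_univ x) y (Finset.mem_univ y) hxy (hx _ rfl) (hy _ rfl)
  exact ⟨⟨M, hM⟩, M, hM, fun x => Option.some_ne_none (f x)⟩
end

section
/- In the profile P constructed from a graph G with maximum degree 3, an integer k ≥ 1, and a proper 4-edge-coloring of G (as described in the context), every stable matching M satisfies: (1) for each j ∈ {1,…,k}, the selector agent b_j^5 is matched to a vertex agent u_i^{10} for some i ∈ {1,…,n}; and (2) no two vertex agents u_i^{10} and u_{i'}^{10} that are both matched to selector agents correspond to adjacent vertices u_i, u_{i'} of G. -/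
/-! The NP-hardness construction: agents of the Stable Roommates profile built from
a graph `G` on `Fin n` with maximum degree 3, an integer `k`, and a proper
4-edge-coloring `col` of `G`. -/

/-- Agents: `Sum.inl (i, z)` is the vertex agent `u_i^{z+1}` (`z : Fin 10`);
`Sum.inr (false, j, z)` is the selector agent `a_j^{z+1}` and
`Sum.inr (true, j, z)` is the selector agent `b_j^{z+1}` (`z : Fin 5`). -/
abbrev SRAgent (n k : ℕ) := (Fin n × Fin 10) ⊕ (Bool × Fin k × Fin 5)

/-- The vertex agent `u_i^{z+1}`. -/
def uA {n k : ℕ} (i : Fin n) (z : Fin 10) : SRAgent n k := Sum.inl (i, z)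

/-- The selector agent `a_j^{z+1}` (for `t = false`) resp. `b_j^{z+1}`
(for `t = true`). -/
def sA {n k : ℕ} (t : Bool) (j : Fin k) (z : Fin 5) : SRAgent n k := Sum.inr (t, j, z)

/-- The index of `u^1` (for the `a`-selectors) resp. of `u^10` (for the
`b`-selectors). -/
def uEnd (t : Bool) : Fin 10 := if t then 9 else 0

/-- Index of the vertex agent `u^{2c}` of color `c + 1` (0-based). -/
def evIx (c : Fin 4) : Fin 10 := ⟨2 * c.1 + 1, by omega⟩

/-- Index of the vertex agent `u^{2c - 1}` of color `c + 1` (0-based). -/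
def evPred (c : Fin 4) : Fin 10 := ⟨2 * c.1, by omega⟩

/-- Index of the vertex agent `u^{2c + 1}` of color `c + 1` (0-based). -/
def evSucc (c : Fin 4) : Fin 10 := ⟨2 * c.1 + 2, by omega⟩

/-- Index of the vertex agent `u^{2c + 2}` of color `c + 1` (0-based). -/
def oddSucc (c : Fin 4) : Fin 10 := ⟨2 * c.1 + 3, by omega⟩

/-- `P` is the profile constructed from the graph `G`, the number `k`, and the
proper 4-edge-coloring `col`. -/
structure IsSRConstruction {n k : ℕ} (G : SimpleGraph (Fin n))
    (col : Sym2 (Fin n) → Fin 4) (P : Profile (SRAgent n k)) : Prop where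
  /-- `a_j^1 : a_j^1 ≻ a_j^5 ≻ a_j^2` (and analogously for `b_j^1`). -/
  acc_s1 : ∀ t j, P.acc (sA t j 0) = {sA t j 0, sA t j 4, sA t j 1}
  s1a : ∀ t j, P.Strict (sA t j 0) (sA t j 0) (sA t j 4)
  s1b : ∀ t j, P.Strict (sA t j 0) (sA t j 4) (sA t j 1)
  /-- `a_j^2 : a_j^2 ≻ a_j^1 ≻ a_j^3`. -/
  acc_s2 : ∀ t j, P.acc (sA t j 1) = {sA t j 1, sA t j 0, sA t j 2}
  s2a : ∀ t j, P.Strict (sA t j 1) (sA t j 1) (sA t j 0)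
  s2b : ∀ t j, P.Strict (sA t j 1) (sA t j 0) (sA t j 2)
  /-- `a_j^3 : a_j^3 ≻ a_j^2 ≻ a_j^4`. -/
  acc_s3 : ∀ t j, P.acc (sA t j 2) = {sA t j 2, sA t j 1, sA t j 3}
  s3a : ∀ t j, P.Strict (sA t j 2) (sA t j 2) (sA t j 1)
  s3b : ∀ t j, P.Strict (sA t j 2) (sA t j 1) (sA t j 3)
  /-- `a_j^4 : a_j^4 ≻ a_j^3 ≻ a_j^5`. -/
  acc_s4 : ∀ t j, P.acc (sA t j 3) = {sA t j 3, sA t j 2, sA t j 4}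
  s4a : ∀ t j, P.Strict (sA t j 3) (sA t j 3) (sA t j 2)
  s4b : ∀ t j, P.Strict (sA t j 3) (sA t j 2) (sA t j 4)
  /-- `a_j^5 : a_j^5 ≻ (U^1) ≻ a_j^4 ≻ a_j^1` (resp. with `U^10` for `b_j^5`). -/
  acc_s5 : ∀ t j, P.acc (sA t j 4) =
      insert (sA t j 4) (Set.range (fun i => uA i (uEnd t)) ∪ {sA t j 3, sA t j 0})
  s5a : ∀ t j i, P.Strict (sA t j 4) (sA t j 4) (uA i (uEnd t))
  s5b : ∀ t j i i', P.Indiff (sA t j 4) (uA i (uEnd t)) (uA i' (uEnd t))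
  s5c : ∀ t j i, P.Strict (sA t j 4) (uA i (uEnd t)) (sA t j 3)
  s5d : ∀ t j, P.Strict (sA t j 4) (sA t j 3) (sA t j 0)
  /-- `u_i^1 : u_i^1 ≻ u_i^10 ≻ a_1^5 ≻ ⋯ ≻ a_k^5 ≻ u_i^2`. -/
  acc_u1 : ∀ i, P.acc (uA i 0) =
      insert (uA i 0) (insert (uA i 9) (Set.range (fun j => sA false j 4) ∪ {uA i 1}))
  u1a : ∀ i, P.Strict (uA i 0) (uA i 0) (uA i 9)
  u1b : ∀ i j, P.Strict (uA i 0) (uA i 9) (sA false j 4)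
  u1c : ∀ i, ∀ j j' : Fin k, j < j' →
      P.Strict (uA i 0) (sA false j 4) (sA false j' 4)
  u1d : ∀ i j, P.Strict (uA i 0) (sA false j 4) (uA i 1)
  /-- `u_i^10 : u_i^10 ≻ u_i^9 ≻ b_1^5 ≻ ⋯ ≻ b_k^5 ≻ u_i^1`. -/
  acc_u10 : ∀ i, P.acc (uA i 9) =
      insert (uA i 9) (insert (uA i 8) (Set.range (fun j => sA true j 4) ∪ {uA i 0}))
  u10a : ∀ i, P.Strict (uA i 9) (uA i 9) (uA i 8)
  u10b : ∀ i j, P.Strict (uA i 9) (uA i 8) (sA true j 4)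
  u10c : ∀ i, ∀ j j' : Fin k, j < j' →
      P.Strict (uA i 9) (sA true j 4) (sA true j' 4)
  u10d : ∀ i j, P.Strict (uA i 9) (sA true j 4) (uA i 0)
  /-- `u_i^z : u_i^z ≻ u_i^{z-1} ≻ u_i^{z+1}` for odd `z ∈ {3, 5, 7, 9}`. -/
  acc_uodd : ∀ i c, P.acc (uA i (evSucc c)) =
      {uA i (evSucc c), uA i (evIx c), uA i (oddSucc c)}
  uodda : ∀ i c, P.Strict (uA i (evSucc c)) (uA i (evSucc c)) (uA i (evIx c))
  uoddb : ∀ i c, P.Strict (uA i (evSucc c)) (uA i (evIx c)) (uA i (oddSucc c))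
  /-- `u_i^{2c} : u_i^{2c} ≻ u_i^{2c-1} ≻ u_{i'}^{2c} ≻ u_i^{2c+1}` when `u_i` is
  incident to the edge `{u_i, u_{i'}}` of color `c`. -/
  acc_uev_adj : ∀ i i' c, G.Adj i i' → col s(i, i') = c →
      P.acc (uA i (evIx c)) =
        {uA i (evIx c), uA i (evPred c), uA i' (evIx c), uA i (evSucc c)}
  uev_adj_a : ∀ i i' c, G.Adj i i' → col s(i, i') = c →
      P.Strict (uA i (evIx c)) (uA i (evIx c)) (uA i (evPred c))
  uev_adj_b : ∀ i i' c, G.Adj i i' → col s(i, i') = c →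
      P.Strict (uA i (evIx c)) (uA i (evPred c)) (uA i' (evIx c))
  uev_adj_c : ∀ i i' c, G.Adj i i' → col s(i, i') = c →
      P.Strict (uA i (evIx c)) (uA i' (evIx c)) (uA i (evSucc c))
  /-- `u_i^{2c} : u_i^{2c} ≻ u_i^{2c-1} ≻ u_i^{2c+1}` when `u_i` has no incident
  edge of color `c`. -/
  acc_uev_free : ∀ i c, (∀ i', G.Adj i i' → col s(i, i') ≠ c) →
      P.acc (uA i (evIx c)) = {uA i (evIx c), uA i (evPred c), uA i (evSucc c)}
  uev_free_a : ∀ i c, (∀ i', G.Adj i i' → col s(i, i') ≠ c) →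
      P.Strict (uA i (evIx c)) (uA i (evIx c)) (uA i (evPred c))
  uev_free_b : ∀ i c, (∀ i', G.Adj i i' → col s(i, i') ≠ c) →
      P.Strict (uA i (evIx c)) (uA i (evPred c)) (uA i (evSucc c))

namespace Profile

variable {V : Type*} {P : Profile V}

lemma Strict.left_mem {i x y : V} (h : P.Strict i x y) : x ∈ P.acc i :=
  (P.pref_mem i x y h.1).1

lemma Strict.right_mem {i x y : V} (h : P.Strict i x y) : y ∈ P.acc i :=
  (P.pref_mem i x y h.1).2

lemma Strict.irrefl {i x : V} : ¬ P.Strict i x x := fun h => h.2 h.1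

lemma Strict.trans {i x y z : V} (h : P.Strict i x y) (h' : P.Strict i y z) : P.Strict i x z :=
  ⟨P.pref_trans i x y z h.1 h'.1, fun hzx => h.2 (P.pref_trans i y z x h'.1 hzx)⟩

namespace Matching

variable {M : P.Matching}

/-- In a stable matching, if `x` would rather be with `y`, then `y` has a partner that it does not
like less than `x`. -/
lemma Stable.exists_partner (hM : M.Stable) {x y : V} (hne : x ≠ y) (hy : y ∈ P.acc x)
    (hx : x ∈ P.acc y) (h : ∀ z, M.m x = some z → P.Strict x y z) :
    ∃ z, M.m y = some z ∧ ¬ P.Strict y x z := by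
  by_contra! hcon
  exact hM x y ⟨hne, hy, hx, fun hxy => Strict.irrefl (h y hxy), h, hcon⟩

/-- In a stable matching, `x` cannot be unmatched if some acceptable `y` is restricted to the
partners `x` and `w` and prefers `x`. -/
lemma Stable.ne_none (hM : M.Stable) {x y w : V} (hne : x ≠ y) (hy : y ∈ P.acc x)
    (hs : P.Strict y x w) (h : ∀ z, M.m y = some z → z = x ∨ z = w) : M.m x ≠ none := by
  intro hx
  obtain ⟨z, hz, hzs⟩ := hM.exists_partner hne hy hs.left_mem (by simp [hx])
  rcases h z hz with rfl | rfl
  · simp [M.symm _ _ hz] at hx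
  · exact hzs hs

/-- A stable matching cannot confine five agents to a cycle in which everyone prefers their
predecessor to their successor. -/
lemma Stable.not_five_cycle (hM : M.Stable) {x : Fin 5 → V} (hinj : Function.Injective x)
    (hs : ∀ z, P.Strict (x z) (x (z - 1)) (x (z + 1)))
    (h : ∀ z w, M.m (x z) = some w → w = x (z - 1) ∨ w = x (z + 1)) : False := by
  have hsucc : ∀ z : Fin 5, z ≠ z + 1 := by decide
  have hsucc₂ : ∀ z : Fin 5, z ≠ z + 2 := by decide
  have hmatch (z : Fin 5) : M.m (x z) = some (x (z - 1)) ∨ M.m (x z) = some (x (z + 1)) := by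
    have hz : z + 1 - 1 = z := by simp
    have hne : M.m (x z) ≠ none :=
      hM.ne_none (y := x (z + 1)) (w := x (z + 1 + 1)) (hinj.ne (hsucc z)) (hs z).right_mem
        (by simpa only [hz] using hs (z + 1)) (by simpa only [hz] using h (z + 1))
    obtain ⟨w, hw⟩ := Option.ne_none_iff_exists'.mp hne
    rcases h z w hw with rfl | rfl <;> simp [hw]
  have hstep (z : Fin 5) (hz : M.m (x z) = some (x (z + 1))) :
      M.m (x (z + 2)) = some (x (z + 2 + 1)) := by
    refine (hmatch (z + 2)).resolve_left fun hl => ?_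
    have hl' := M.symm _ _ hl
    rw [show z + 2 - 1 = z + 1 by grind, M.symm _ _ hz] at hl'
    exact hsucc₂ z (hinj (Option.some_inj.mp hl'))
  have hforward : ∃ z, M.m (x z) = some (x (z + 1)) := by
    rcases hmatch 0 with h0 | h0
    · exact ⟨0 - 1, by simpa using M.symm _ _ h0⟩
    · exact ⟨0, h0⟩
  obtain ⟨z, hz⟩ := hforward
  have hround := hstep _ (hstep _ (hstep _ hz))
  rw [show z + 2 + 2 + 2 = z + 1 by grind, M.symm _ _ hz, show z + 1 + 1 = z + 2 by grind]
    at hround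
  exact hsucc₂ z (hinj (Option.some_inj.mp hround))

end Matching

end Profile

namespace IsSRConstruction

variable {n k : ℕ} {G : SimpleGraph (Fin n)} {col : Sym2 (Fin n) → Fin 4}
  {P : Profile (SRAgent n k)} {M : P.Matching}

/-- In a stable matching every selector agent `a_j^5` or `b_j^5` is matched to a vertex agent. -/
lemma selector_matched (hP : IsSRConstruction G col P) (hM : M.Stable) (t : Bool) (j : Fin k) :
    ∃ i, M.m (sA t j 4) = some (uA i (uEnd t)) := by
  by_contra! hcon
  refine hM.not_five_cycle (x := sA t j) (fun z w h => by simpa [sA] using h) ?_ ?_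
  · intro z
    fin_cases z
    exacts [hP.s1b t j, hP.s2b t j, hP.s3b t j, hP.s4b t j, hP.s5d t j]
  · intro z w hw
    have hne := M.ne _ _ hw
    have hacc := (M.mutual_acc _ _ hw).1
    fin_cases z
    · exact ((hP.acc_s1 t j).subset hacc).resolve_left hne.symm
    · exact ((hP.acc_s2 t j).subset hacc).resolve_left hne.symm
    · exact ((hP.acc_s3 t j).subset hacc).resolve_left hne.symm
    · exact ((hP.acc_s4 t j).subset hacc).resolve_left hne.symm
    · rcases ((hP.acc_s5 t j).subset hacc).resolve_left hne.symm with ⟨i, rfl⟩ | h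
      · exact absurd hw (hcon i)
      · exact h

lemma strict_even (hP : IsSRConstruction G col P) (i : Fin n) (c : Fin 4) :
    P.Strict (uA i (evIx c)) (uA i (evPred c)) (uA i (evSucc c)) := by
  by_cases h : ∃ i', G.Adj i i' ∧ col s(i, i') = c
  · obtain ⟨i', hadj, hc⟩ := h
    exact (hP.uev_adj_b i i' c hadj hc).trans (hP.uev_adj_c i i' c hadj hc)
  · exact hP.uev_free_b i c (by simpa using h)

/-- If `u_i^{2c+2}` prefers `u_i^{2c+1}` to its partner, then `u_i^{2c}` is matched to
`u_i^{2c+1}`. -/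
lemma matched_even_of_strict (hP : IsSRConstruction G col P) (hM : M.Stable) {i : Fin n}
    {c : Fin 4} {w : SRAgent n k} (hw : M.m (uA i (oddSucc c)) = some w)
    (hs : P.Strict (uA i (oddSucc c)) (uA i (evSucc c)) w) :
    M.m (uA i (evIx c)) = some (uA i (evSucc c)) := by
  have hb := hP.uoddb i c
  obtain ⟨z, hz, hzs⟩ := hM.exists_partner (x := uA i (oddSucc c)) (y := uA i (evSucc c))
    (by simp [uA, oddSucc, evSucc]) hs.left_mem hb.right_mem
    (fun z hz => by rw [hw] at hz; cases hz; exact hs)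
  rcases (hP.acc_uodd i c).subset (M.mutual_acc _ _ hz).1 with rfl | rfl | rfl
  · exact absurd rfl (M.ne _ _ hz)
  · exact M.symm _ _ hz
  · rw [M.symm _ _ hz] at hw
    cases hw
    exact absurd hs Profile.Strict.irrefl

/-- If `u_i^10` is matched to a selector agent, then `u_i^{2c}` is matched to `u_i^{2c+1}` for every
color. -/
lemma matched_even_of_selected (hP : IsSRConstruction G col P) (hM : M.Stable) {i : Fin n}
    {s : Bool × Fin k × Fin 5} (hs : M.m (uA i 9) = some (Sum.inr s)) (c : Fin 4) :
    M.m (uA i (evIx c)) = some (uA i (evSucc c)) := by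
  have h3 : M.m (uA i (evIx 3)) = some (uA i (evSucc 3)) := by
    refine hP.matched_even_of_strict hM (w := Sum.inr s) hs ?_
    have hacc := (M.mutual_acc _ _ hs).1
    rw [hP.acc_u10] at hacc
    rcases hacc with h | h | ⟨j, h⟩ | h
    · cases h
    · cases h
    · exact h ▸ hP.u10b i j
    · cases h
  have h2 := hP.matched_even_of_strict (c := 2) hM h3 (hP.strict_even i 3)
  have h1 := hP.matched_even_of_strict (c := 1) hM h2 (hP.strict_even i 2)
  have h0 := hP.matched_even_of_strict (c := 0) hM h1 (hP.strict_even i 1)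
  fin_cases c
  exacts [h0, h1, h2, h3]

end IsSRConstruction

/-- In the profile constructed from a graph `G` with maximum
degree 3, an integer `k ≥ 1` and a proper 4-edge-coloring of `G`, every stable
matching `M` satisfies: (1) each selector agent `b_j^5` is matched to a vertex
agent `u_i^10`; and (2) no two vertex agents `u_i^10`, `u_{i'}^10` that are both
matched to selector agents correspond to adjacent vertices of `G`. -/
theorem construction_stable_matching_properties {n k : ℕ} (hk : 1 ≤ k)
    (G : SimpleGraph (Fin n))
    (hdeg : ∀ v : Fin n, {w | G.Adj v w}.ncard ≤ 3)
    (col : Sym2 (Fin n) → Fin 4)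
    (hcol : ∀ v w w' : Fin n, G.Adj v w → G.Adj v w' → w ≠ w' →
      col s(v, w) ≠ col s(v, w'))
    (P : Profile (SRAgent n k)) (hP : IsSRConstruction G col P)
    (M : P.Matching) (hM : M.Stable) :
    (∀ j : Fin k, ∃ i : Fin n, M.m (sA true j 4) = some (uA i 9)) ∧
    (∀ i i' : Fin n,
      (∃ s, M.m (uA i 9) = some (Sum.inr s)) →
      (∃ s, M.m (uA i' 9) = some (Sum.inr s)) →
      i ≠ i' → ¬ G.Adj i i') := by
  refine ⟨hP.selector_matched hM true, ?_⟩
  rintro i i' ⟨s, hs⟩ ⟨s', hs'⟩ hne hadj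
  have hi := hP.matched_even_of_selected hM hs (col s(i, i'))
  have hi' := hP.matched_even_of_selected hM hs' (col s(i, i'))
  have hc := hP.uev_adj_c i i' _ hadj rfl
  have hc' := hP.uev_adj_c i' i (col s(i, i')) hadj.symm (by rw [Sym2.eq_swap])
  obtain ⟨z, hz, hzs⟩ := hM.exists_partner (by simpa [uA] using hne) hc.left_mem hc'.left_mem
    (fun z hz => by rw [hi] at hz; cases hz; exact hc)
  rw [hi'] at hz
  cases hz
  exact hzs hc'
end
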